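/- Let Ψ and Φ be unit vectors in H = ℂ^{d_A} ⊗ ℂ^{d_B}, let t ∈ (0,1) and θ, φ ∈ ℝ, define χ̃₁ = √t·cosθ·Ψ + √(1−t)·e^{iφ}·sinθ·Φ and χ̃₂ = −√t·e^{−iφ}·sinθ·Ψ + √(1−t)·cosθ·Φ, and set q = ‖χ̃₁‖². If 0 < q < 1, then q·E(χ̃₁) + (1−q)·E(χ̃₂) ≤ t·E(Ψ) + (1−t)·E(Φ) + h₂(t); consequently E(χ̃₁) ≤ (1/q)·[ t·E(Ψ) + (1−t)·E(Φ) + h₂(t) ]. -/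

import Mathlib

open scoped BigOperators

noncomputable section

namespace EoS

/-- Vectors of `ℂ^{dA} ⊗ ℂ^{dB}`, modeled as `EuclideanSpace ℂ (Fin dA × Fin dB)`. -/
abbrev TensorSpace (dA dB : ℕ) := EuclideanSpace ℂ (Fin dA × Fin dB)

variable {dA dB : ℕ}

/-- The rank-one operator `|ψ⟩⟨ψ| = ψ ψ†`, as a matrix. -/
def ketbra (ψ : TensorSpace dA dB) : Matrix (Fin dA × Fin dB) (Fin dA × Fin dB) ℂ :=
  fun p q => ψ p * (starRingEnd ℂ) (ψ q)

/-- Partial trace over the `B` system. -/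
def trB (ρ : Matrix (Fin dA × Fin dB) (Fin dA × Fin dB) ℂ) : Matrix (Fin dA) (Fin dA) ℂ :=
  fun a a' => ∑ b : Fin dB, ρ (a, b) (a', b)

/-- Partial trace over the `A` system. -/
def trA (ρ : Matrix (Fin dA × Fin dB) (Fin dA × Fin dB) ℂ) : Matrix (Fin dB) (Fin dB) ℂ :=
  fun b b' => ∑ a : Fin dA, ρ (a, b) (a, b')

open scoped Classical in
/-- Von Neumann entropy (base-2), via eigenvalues; junk value `0` on non-Hermitian input. -/
def vnEntropy {n : Type*} [Fintype n] [DecidableEq n] (ρ : Matrix n n ℂ) : ℝ :=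
  if h : ρ.IsHermitian then -∑ i, (h.eigenvalues i) * Real.logb 2 (h.eigenvalues i) else 0

/-- Entropy of entanglement of a (unit) vector. -/
def ent (ψ : TensorSpace dA dB) : ℝ := vnEntropy (trB (ketbra ψ))

/-- Entropy of entanglement of a nonzero, not necessarily normalized, vector. -/
def entN (ψ : TensorSpace dA dB) : ℝ := ent ((‖ψ‖ : ℝ)⁻¹ • ψ)

/-- Binary entropy (base 2). -/
def h2 (x : ℝ) : ℝ := -x * Real.logb 2 x - (1 - x) * Real.logb 2 (1 - x)

/-- Elementary tensor `u ⊗ w`. -/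
def tensor (u : EuclideanSpace ℂ (Fin dA)) (w : EuclideanSpace ℂ (Fin dB)) :
    TensorSpace dA dB := WithLp.toLp 2 (fun p => u p.1 * w p.2)

/-- One-sided orthogonality on the `B` side:
`Tr[Tr_A(|Ψ⟩⟨Ψ|) ⬝ Tr_A(|Φ⟩⟨Φ|)] = 0`. -/
def OneSidedOrthB (Ψ Φ : TensorSpace dA dB) : Prop :=
  Matrix.trace (trA (ketbra Ψ) * trA (ketbra Φ)) = 0



open scoped InnerProductSpace ComplexOrder

/-- Jensen for `negMulLog` with substochastic weights. -/
lemma jensen_sub {κ : Type*} [Fintype κ] (w x : κ → ℝ) (hw : ∀ k, 0 ≤ w k)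
    (hs : ∑ k, w k ≤ 1) (hx : ∀ k, 0 ≤ x k) :
    ∑ k, w k * Real.negMulLog (x k) ≤ Real.negMulLog (∑ k, w k * x k) := by
  have h := Real.concaveOn_negMulLog.le_map_sum (t := (Finset.univ : Finset (Option κ)))
    (w := fun o => o.elim (1 - ∑ k, w k) w) (p := fun o => o.elim 0 x)
    (by rintro (_ | k) _ <;> simp [hw, hs])
    (by simp [Fintype.sum_option])
    (by rintro (_ | k) _ <;> simp [hx])
  simpa [Fintype.sum_option] using h

/-- Quadratic form of a matrix. -/
def quad {n : Type*} [Fintype n] [DecidableEq n] (A : Matrix n n ℂ) (x : EuclideanSpace ℂ n) : ℝ :=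
  (⟪x, Matrix.toEuclideanLin A x⟫_ℂ).re

lemma quad_add {n : Type*} [Fintype n] [DecidableEq n] (A B : Matrix n n ℂ)
    (x : EuclideanSpace ℂ n) : quad (A + B) x = quad A x + quad B x := by
  simp [quad]

lemma quad_smul {n : Type*} [Fintype n] [DecidableEq n] (c : ℝ) (A : Matrix n n ℂ)
    (x : EuclideanSpace ℂ n) : quad ((c : ℂ) • A) x = c * quad A x := by
  rw [quad, map_smul, LinearMap.smul_apply, inner_smul_right, Complex.re_ofReal_mul, quad]

lemma quad_eq {n : Type*} [Fintype n] [DecidableEq n] {A : Matrix n n ℂ} (hA : A.IsHermitian)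
    (x : EuclideanSpace ℂ n) :
    quad A x = ∑ k, hA.eigenvalues k * ‖⟪hA.eigenvectorBasis k, x⟫_ℂ‖ ^ 2 := by
  have hT := Matrix.isSymmetric_toEuclideanLin_iff.mpr hA
  have he : ∀ k, Matrix.toEuclideanLin A (hA.eigenvectorBasis k)
      = (hA.eigenvalues k : ℂ) • hA.eigenvectorBasis k := by
    intro k
    have := hA.mulVec_eigenvectorBasis k
    rw [Matrix.toLpLin_apply, this]
    ext i
    simp
  unfold quad
  rw [← hA.eigenvectorBasis.sum_inner_mul_inner, Complex.re_sum]
  refine Finset.sum_congr rfl fun k _ => ?_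
  rw [← hT, he, inner_smul_left, ← inner_conj_symm, ← mul_assoc,
    mul_comm _ ((starRingEnd ℂ) (hA.eigenvalues k : ℂ)), mul_assoc, Complex.conj_mul']
  rw [Complex.conj_ofReal, ← Complex.ofReal_pow, ← Complex.ofReal_mul, Complex.ofReal_re]

lemma diag_bound {n : Type*} [Fintype n] [DecidableEq n] {A : Matrix n n ℂ} (hA : A.PosSemidef)
    (b : OrthonormalBasis n ℂ (EuclideanSpace ℂ n)) :
    ∑ k, Real.negMulLog (hA.1.eigenvalues k) ≤ ∑ i, Real.negMulLog (quad A (b i)) := by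
  have h : ∀ i, ∑ k, ‖⟪hA.1.eigenvectorBasis k, b i⟫_ℂ‖ ^ 2 *
      Real.negMulLog (hA.1.eigenvalues k) ≤ Real.negMulLog (quad A (b i)) := by
    intro i
    rw [quad_eq hA.1]
    simp_rw [mul_comm (hA.1.eigenvalues _)]
    refine jensen_sub _ _ (fun _ => by positivity) ?_ hA.eigenvalues_nonneg
    rw [OrthonormalBasis.sum_sq_norm_inner_right]
    simp
  refine le_trans (le_of_eq ?_) (Finset.sum_le_sum fun i _ => h i)
  rw [Finset.sum_comm]
  refine Finset.sum_congr rfl fun k _ => ?_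
  rw [← Finset.sum_mul, OrthonormalBasis.sum_sq_norm_inner_left]
  simp

lemma ensemble_bound {n ι : Type*} [Fintype n] [DecidableEq n] [Fintype ι]
    (e : OrthonormalBasis n ℂ (EuclideanSpace ℂ n)) (l : n → ℝ) (hl : ∀ k, 0 ≤ l k)
    (w : ι → EuclideanSpace ℂ n)
    (h : ∀ x, ∑ k, l k * ‖⟪e k, x⟫_ℂ‖ ^ 2 = ∑ j, ‖⟪w j, x⟫_ℂ‖ ^ 2) :
    ∑ k, Real.negMulLog (l k) ≤ ∑ j, Real.negMulLog (‖w j‖ ^ 2) := by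
  have ha : ∀ k, l k = ∑ j, ‖⟪e k, w j⟫_ℂ‖ ^ 2 := by
    intro k
    have := h (e k)
    simp_rw [norm_inner_symm (w _)] at this
    rw [← this, Finset.sum_eq_single k]
    · simp
    · intro b _ hb
      simp [e.inner_eq_zero hb]
    · simp
  have hz : ∀ k, l k = 0 → ∀ j, ‖⟪e k, w j⟫_ℂ‖ ^ 2 = 0 := by
    intro k hk j
    rw [ha k] at hk
    exact (Finset.sum_eq_zero_iff_of_nonneg (fun _ _ => by positivity)).1 hk j (Finset.mem_univ _)
  have hb : ∀ j, ‖w j‖ ^ 2 = ∑ k, (‖⟪e k, w j⟫_ℂ‖ ^ 2 / l k) * l k := by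
    intro j
    rw [← e.sum_sq_norm_inner_right]
    refine Finset.sum_congr rfl fun k _ => ?_
    by_cases hk : l k = 0
    · rw [hz k hk j]; simp
    · field_simp
  have hc : ∀ j, ∑ k, (‖⟪e k, w j⟫_ℂ‖ ^ 2 / l k) ≤ 1 := by
    intro j
    set s := ∑ k, (‖⟪e k, w j⟫_ℂ‖ ^ 2 / l k) with hs
    let x : EuclideanSpace ℂ n := ∑ k, ((((l k)⁻¹ : ℝ) : ℂ) * ⟪e k, w j⟫_ℂ) • e k
    have hx : ∀ k, ⟪e k, x⟫_ℂ = (((l k)⁻¹ : ℝ) : ℂ) * ⟪e k, w j⟫_ℂ := fun k =>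
      e.orthonormal.inner_right_fintype _ k
    have h1 : ∑ k, l k * ‖⟪e k, x⟫_ℂ‖ ^ 2 = s := by
      refine Finset.sum_congr rfl fun k _ => ?_
      rw [hx, norm_mul, Complex.norm_real, Real.norm_of_nonneg (inv_nonneg.2 (hl k))]
      by_cases hk : l k = 0
      · simp [hk]
      · field_simp
    have h2 : ⟪w j, x⟫_ℂ = (s : ℂ) := by
      rw [← e.sum_inner_mul_inner, hs, Complex.ofReal_sum]
      refine Finset.sum_congr rfl fun k _ => ?_
      rw [hx, ← inner_conj_symm, mul_left_comm, Complex.conj_mul']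
      push_cast
      rw [mul_comm, div_eq_mul_inv]
    have h3 : s ^ 2 ≤ s := by
      have := Finset.single_le_sum (f := fun j => ‖⟪w j, x⟫_ℂ‖ ^ 2) (s := Finset.univ)
        (fun _ _ => by positivity) (Finset.mem_univ j)
      rw [← h x, h1] at this
      simpa [h2] using this
    nlinarith
  calc ∑ k, Real.negMulLog (l k)
      = ∑ k, ∑ j, (‖⟪e k, w j⟫_ℂ‖ ^ 2 / l k) * Real.negMulLog (l k) := by
        refine Finset.sum_congr rfl fun k _ => ?_
        rw [← Finset.sum_mul, ← Finset.sum_div, ← ha]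
        by_cases hk : l k = 0
        · simp [hk]
        · field_simp
    _ = ∑ j, ∑ k, (‖⟪e k, w j⟫_ℂ‖ ^ 2 / l k) * Real.negMulLog (l k) := Finset.sum_comm
    _ ≤ _ := by
        refine Finset.sum_le_sum fun j _ => ?_
        rw [hb j]
        exact jensen_sub _ _ (fun k => div_nonneg (by positivity) (hl k)) (hc j) hl

lemma vn_eq {n : Type*} [Fintype n] [DecidableEq n] {A : Matrix n n ℂ} (hA : A.IsHermitian) :
    vnEntropy A = (∑ k, Real.negMulLog (hA.eigenvalues k)) / Real.log 2 := by
  rw [vnEntropy, dif_pos hA, Finset.sum_div, ← Finset.sum_neg_distrib]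
  refine Finset.sum_congr rfl fun k _ => ?_
  rw [Real.negMulLog, Real.logb]
  ring

lemma log2_pos : 0 < Real.log 2 := Real.log_pos (by norm_num)

lemma h2_eq (t : ℝ) : h2 t = (Real.negMulLog t + Real.negMulLog (1 - t)) / Real.log 2 := by
  rw [h2, Real.negMulLog, Real.negMulLog, Real.logb, Real.logb]
  ring

lemma trace_eig {n : Type*} [Fintype n] [DecidableEq n] {A : Matrix n n ℂ} (hA : A.IsHermitian)
    (h : A.trace = 1) : ∑ k, hA.eigenvalues k = 1 := by
  rw [hA.trace_eq_sum_eigenvalues] at h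
  have h' := congrArg Complex.re h
  rw [Complex.re_sum] at h'
  simpa using h'

lemma vn_nonneg {n : Type*} [Fintype n] [DecidableEq n] {A : Matrix n n ℂ} (hA : A.PosSemidef)
    (h : A.trace = 1) : 0 ≤ vnEntropy A := by
  rw [vn_eq hA.1]
  refine div_nonneg (Finset.sum_nonneg fun k _ => ?_) log2_pos.le
  refine Real.negMulLog_nonneg (hA.eigenvalues_nonneg k) ?_
  rw [← trace_eig hA.1 h]
  exact Finset.single_le_sum (fun k _ => hA.eigenvalues_nonneg k) (Finset.mem_univ k)

lemma psd_smul {n : Type*} [Fintype n] [DecidableEq n] {A : Matrix n n ℂ} (hA : A.PosSemidef)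
    {c : ℝ} (hc : 0 ≤ c) : ((c : ℂ) • A).PosSemidef :=
  hA.smul (by exact_mod_cast hc)

lemma quad_nonneg {n : Type*} [Fintype n] [DecidableEq n] {A : Matrix n n ℂ} (hA : A.PosSemidef)
    (x : EuclideanSpace ℂ n) : 0 ≤ quad A x := by
  rw [quad_eq hA.1]
  exact Finset.sum_nonneg fun k _ => mul_nonneg (hA.eigenvalues_nonneg k) (by positivity)

lemma quad_self {n : Type*} [Fintype n] [DecidableEq n] {A : Matrix n n ℂ} (hA : A.IsHermitian)
    (k : n) : quad A (hA.eigenvectorBasis k) = hA.eigenvalues k := by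
  rw [quad_eq hA, Finset.sum_eq_single k]
  · simp
  · intro b _ hb
    simp [hA.eigenvectorBasis.inner_eq_zero hb]
  · simp

/-- Concavity of the entropy. -/
lemma vn_concave {n : Type*} [Fintype n] [DecidableEq n] {A B : Matrix n n ℂ}
    (hA : A.PosSemidef) (hB : B.PosSemidef) {q : ℝ} (h0 : 0 ≤ q) (h1 : q ≤ 1) :
    q * vnEntropy A + (1 - q) * vnEntropy B ≤
      vnEntropy ((q : ℂ) • A + ((1 - q : ℝ) : ℂ) • B) := by
  have hR := (psd_smul hA h0).add (psd_smul hB (sub_nonneg.2 h1))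
  rw [vn_eq hA.1, vn_eq hB.1, vn_eq hR.1, ← mul_div_assoc, ← mul_div_assoc, ← add_div]
  refine div_le_div_of_nonneg_right ?_ log2_pos.le
  have a1 := diag_bound hA hR.1.eigenvectorBasis
  have b1 := diag_bound hB hR.1.eigenvectorBasis
  calc _ ≤ q * ∑ i, Real.negMulLog (quad A (hR.1.eigenvectorBasis i))
        + (1 - q) * ∑ i, Real.negMulLog (quad B (hR.1.eigenvectorBasis i)) := by
        have := sub_nonneg.2 h1
        gcongr
    _ ≤ _ := by
        rw [Finset.mul_sum, Finset.mul_sum, ← Finset.sum_add_distrib]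
        refine Finset.sum_le_sum fun i _ => ?_
        have := Real.concaveOn_negMulLog.2 (quad_nonneg hA (hR.1.eigenvectorBasis i))
          (quad_nonneg hB (hR.1.eigenvectorBasis i)) h0 (sub_nonneg.2 h1) (by ring)
        rw [smul_eq_mul, smul_eq_mul, smul_eq_mul, smul_eq_mul, ← quad_smul, ← quad_smul,
          ← quad_add, quad_self hR.1] at this
        exact this

/-- Mixing bound for the entropy. -/
lemma vn_mix {n : Type*} [Fintype n] [DecidableEq n] {A B : Matrix n n ℂ}
    (hA : A.PosSemidef) (hB : B.PosSemidef) (tA : A.trace = 1) (tB : B.trace = 1)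
    {q : ℝ} (h0 : 0 ≤ q) (h1 : q ≤ 1) :
    vnEntropy ((q : ℂ) • A + ((1 - q : ℝ) : ℂ) • B) ≤
      q * vnEntropy A + (1 - q) * vnEntropy B + h2 q := by
  have h1' := sub_nonneg.2 h1
  have hR := (psd_smul hA h0).add (psd_smul hB h1')
  rw [vn_eq hA.1, vn_eq hB.1, vn_eq hR.1, h2_eq, ← mul_div_assoc, ← mul_div_assoc, ← add_div,
    ← add_div]
  refine div_le_div_of_nonneg_right ?_ log2_pos.le
  let w : n ⊕ n → EuclideanSpace ℂ n := Sum.elim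
    (fun k => ((√(q * hA.1.eigenvalues k) : ℝ) : ℂ) • hA.1.eigenvectorBasis k)
    (fun k => ((√((1 - q) * hB.1.eigenvalues k) : ℝ) : ℂ) • hB.1.eigenvectorBasis k)
  have key := ensemble_bound hR.1.eigenvectorBasis hR.1.eigenvalues hR.eigenvalues_nonneg w ?_
  · refine key.trans (le_of_eq ?_)
    have e1 : ∀ k, ‖w (Sum.inl k)‖ ^ 2 = q * hA.1.eigenvalues k := fun k => by
      simp [w, norm_smul, Real.sq_sqrt (mul_nonneg h0 (hA.eigenvalues_nonneg k))]
    have e2 : ∀ k, ‖w (Sum.inr k)‖ ^ 2 = (1 - q) * hB.1.eigenvalues k := fun k => by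
      simp [w, norm_smul, Real.sq_sqrt (mul_nonneg h1' (hB.eigenvalues_nonneg k))]
    rw [Fintype.sum_sum_type]
    simp_rw [e1, e2, Real.negMulLog_mul, Finset.sum_add_distrib, ← Finset.sum_mul,
      ← Finset.mul_sum, trace_eig hA.1 tA, trace_eig hB.1 tB]
    ring
  · intro x
    rw [← quad_eq hR.1, quad_add, quad_smul, quad_smul, quad_eq hA.1, quad_eq hB.1,
      Fintype.sum_sum_type, Finset.mul_sum, Finset.mul_sum]
    congr 1 <;> refine Finset.sum_congr rfl fun k _ => ?_
    · simp [w, mul_pow,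
        Real.sq_sqrt (mul_nonneg h0 (hA.eigenvalues_nonneg k)), mul_assoc]
    · simp [w, mul_pow,
        Real.sq_sqrt (mul_nonneg h1' (hB.eigenvalues_nonneg k)), mul_assoc]

lemma red_psd (ψ : TensorSpace dA dB) : (trB (ketbra ψ)).PosSemidef := by
  have := Matrix.posSemidef_self_mul_conjTranspose
    (Matrix.of fun (a : Fin dA) (b : Fin dB) => ψ (a, b))
  convert this using 1
  ext a a'
  simp [trB, ketbra, Matrix.mul_apply]

lemma red_trace (ψ : TensorSpace dA dB) : (trB (ketbra ψ)).trace = ((‖ψ‖ ^ 2 : ℝ) : ℂ) := by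
  rw [EuclideanSpace.norm_sq_eq, Fintype.sum_prod_type]
  simp [Matrix.trace, trB, ketbra, Complex.mul_conj']

lemma red_smul (c : ℝ) (ψ : TensorSpace dA dB) :
    trB (ketbra (c • ψ)) = ((c ^ 2 : ℝ) : ℂ) • trB (ketbra ψ) := by
  ext a a'
  simp only [trB, ketbra, Matrix.smul_apply, smul_eq_mul, Finset.mul_sum, PiLp.smul_apply,
    Complex.real_smul, map_mul, Complex.conj_ofReal]
  refine Finset.sum_congr rfl fun b _ => ?_
  push_cast
  ring

lemma red_normalized {ψ : TensorSpace dA dB} {q : ℝ} (hq : ‖ψ‖ ^ 2 = q) (h : 0 < q) :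
    (q : ℂ) • trB (ketbra ((‖ψ‖ : ℝ)⁻¹ • ψ)) = trB (ketbra ψ) := by
  rw [red_smul, smul_smul, ← Complex.ofReal_mul, inv_pow, hq, mul_inv_cancel₀ h.ne']
  simp

lemma red_normalized_trace {ψ : TensorSpace dA dB} {q : ℝ} (hq : ‖ψ‖ ^ 2 = q) (h : 0 < q) :
    (trB (ketbra ((‖ψ‖ : ℝ)⁻¹ • ψ))).trace = 1 := by
  rw [red_smul, Matrix.trace_smul, red_trace, smul_eq_mul, ← Complex.ofReal_mul, inv_pow, hq,
    inv_mul_cancel₀ h.ne']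
  simp

/-- The unitary mixing identity. -/
lemma red_mix (Ψ Φ χ₁ χ₂ : TensorSpace dA dB) (t : ℝ) (ht0 : 0 < t) (ht1 : t < 1) (θ φ : ℝ)
    (hχ₁ : χ₁ = ((Real.sqrt t * Real.cos θ : ℝ) : ℂ) • Ψ
        + (((Real.sqrt (1 - t) : ℝ) : ℂ) * Complex.exp (Complex.I * φ)
            * ((Real.sin θ : ℝ) : ℂ)) • Φ)
    (hχ₂ : χ₂ = (-(((Real.sqrt t : ℝ) : ℂ)) * Complex.exp (-(Complex.I * φ))
            * ((Real.sin θ : ℝ) : ℂ)) • Ψ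
        + (((Real.sqrt (1 - t) * Real.cos θ : ℝ) : ℂ)) • Φ) :
    trB (ketbra χ₁) + trB (ketbra χ₂) =
      (t : ℂ) • trB (ketbra Ψ) + ((1 - t : ℝ) : ℂ) • trB (ketbra Φ) := by
  have s1 : ((√t : ℝ) : ℂ) ^ 2 = t := by rw [← Complex.ofReal_pow, Real.sq_sqrt ht0.le]
  have s2 : ((√(1 - t) : ℝ) : ℂ) ^ 2 = ((1 - t : ℝ) : ℂ) := by
    rw [← Complex.ofReal_pow, Real.sq_sqrt (sub_nonneg.2 ht1.le)]
  have s3 : ((Real.sin θ : ℝ) : ℂ) ^ 2 + ((Real.cos θ : ℝ) : ℂ) ^ 2 = 1 := by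
    rw [← Complex.ofReal_pow, ← Complex.ofReal_pow, ← Complex.ofReal_add,
      Real.sin_sq_add_cos_sq, Complex.ofReal_one]
  have s4 : Complex.exp (Complex.I * φ) * Complex.exp (-(Complex.I * φ)) = 1 := by
    rw [← Complex.exp_add]; simp
  have s5 : (starRingEnd ℂ) (Complex.exp (Complex.I * φ)) = Complex.exp (-(Complex.I * φ)) := by
    rw [← Complex.exp_conj]; simp
  have s6 : (starRingEnd ℂ) (Complex.exp (-(Complex.I * φ))) = Complex.exp (Complex.I * φ) := by
    rw [← s5, Complex.conj_conj]
  ext a a'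
  simp only [Matrix.add_apply, Matrix.smul_apply, trB, ketbra, smul_eq_mul, Finset.mul_sum,
    ← Finset.sum_add_distrib]
  refine Finset.sum_congr rfl fun b _ => ?_
  rw [hχ₁, hχ₂]
  simp only [PiLp.add_apply, PiLp.smul_apply, smul_eq_mul, map_add, map_mul, map_neg,
    Complex.conj_ofReal, s5, s6, Complex.ofReal_mul]
  generalize Complex.exp (Complex.I * φ) = u at *
  generalize Complex.exp (-(Complex.I * φ)) = v at *
  generalize ((Real.sin θ : ℝ) : ℂ) = s at *
  generalize ((Real.cos θ : ℝ) : ℂ) = c at *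
  rw [← s1, ← s2]
  generalize ((√t : ℝ) : ℂ) = x at *
  generalize ((√(1 - t) : ℝ) : ℂ) = y at *
  generalize (starRingEnd ℂ) (Ψ (a', b)) = p' at *
  generalize (starRingEnd ℂ) (Φ (a', b)) = f' at *
  generalize Ψ (a, b) = p at *
  generalize Φ (a, b) = f at *
  linear_combination (x ^ 2 * p * p' + y ^ 2 * f * f') * s3
    + s ^ 2 * (x ^ 2 * p * p' + y ^ 2 * f * f') * s4

/-- averaged entanglement of the rotated decomposition is bounded by
`tE(Ψ) + (1−t)E(Φ) + h₂(t)`; consequently `E(χ̃₁) ≤ (1/q)[tE(Ψ) + (1−t)E(Φ) + h₂(t)]`. -/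
theorem rotated_decomposition_entanglement_bound {dA dB : ℕ}
    (Ψ Φ : TensorSpace dA dB) (hΨ : ‖Ψ‖ = 1) (hΦ : ‖Φ‖ = 1)
    (t : ℝ) (ht0 : 0 < t) (ht1 : t < 1) (θ φ : ℝ)
    (χ₁ χ₂ : TensorSpace dA dB)
    (hχ₁ : χ₁ = ((Real.sqrt t * Real.cos θ : ℝ) : ℂ) • Ψ
        + (((Real.sqrt (1 - t) : ℝ) : ℂ) * Complex.exp (Complex.I * φ)
            * ((Real.sin θ : ℝ) : ℂ)) • Φ)
    (hχ₂ : χ₂ = (-(((Real.sqrt t : ℝ) : ℂ)) * Complex.exp (-(Complex.I * φ))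
            * ((Real.sin θ : ℝ) : ℂ)) • Ψ
        + (((Real.sqrt (1 - t) * Real.cos θ : ℝ) : ℂ)) • Φ)
    (q : ℝ) (hq : q = ‖χ₁‖ ^ 2) (hq0 : 0 < q) (hq1 : q < 1) :
    q * entN χ₁ + (1 - q) * entN χ₂ ≤ t * ent Ψ + (1 - t) * ent Φ + h2 t ∧
    entN χ₁ ≤ (1 / q) * (t * ent Ψ + (1 - t) * ent Φ + h2 t) := by
  have hmix := red_mix Ψ Φ χ₁ χ₂ t ht0 ht1 θ φ hχ₁ hχ₂
  have tΨ : (trB (ketbra Ψ)).trace = 1 := by rw [red_trace, hΨ]; simp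
  have tΦ : (trB (ketbra Φ)).trace = 1 := by rw [red_trace, hΦ]; simp
  have hq2 : ‖χ₂‖ ^ 2 = 1 - q := by
    have := congrArg Matrix.trace hmix
    rw [Matrix.trace_add, Matrix.trace_add, Matrix.trace_smul, Matrix.trace_smul, tΨ, tΦ,
      red_trace, red_trace, ← hq, smul_eq_mul, smul_eq_mul, mul_one, mul_one] at this
    have h : q + ‖χ₂‖ ^ 2 = t + (1 - t) := by exact_mod_cast this
    linarith
  have hq1' : 0 < 1 - q := sub_pos.2 hq1
  have main : q * entN χ₁ + (1 - q) * entN χ₂ ≤ t * ent Ψ + (1 - t) * ent Φ + h2 t := by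
    have c := vn_concave (red_psd ((‖χ₁‖ : ℝ)⁻¹ • χ₁)) (red_psd ((‖χ₂‖ : ℝ)⁻¹ • χ₂))
      hq0.le hq1.le
    rw [red_normalized hq.symm hq0, red_normalized hq2 hq1', hmix] at c
    exact c.trans (vn_mix (red_psd Ψ) (red_psd Φ) tΨ tΦ ht0.le ht1.le)
  refine ⟨main, ?_⟩
  have hn : 0 ≤ entN χ₂ := vn_nonneg (red_psd _) (red_normalized_trace hq2 hq1')
  rw [one_div, inv_mul_eq_div, le_div_iff₀ hq0]
  nlinarith [mul_nonneg hq1'.le hn]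

end EoS
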